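/- arXiv:1906.03668 — 2 statements merged into one kernel-verified Lean document; each statement's English description precedes it below -/
import Mathlib

section
/- Let n ≥ 3 be an integer and let q(x) = (n/2)·(sin((n+1)x)/(n+2) − sin((n−1)x)/(n−2)). Then ∫_{−π}^{π} cos²(n·x)·sin²(x) dx − ∫_{−π}^{π} cos(n·x)·q(x)·sin(x) dx = −2π/(n² − 4), which is strictly negative. (Equivalently, ∫_{−π}^{π} cos²(nx)sin²(x) dx = π/2 and ∫_{−π}^{π} cos(nx)q(x)sin(x) dx = (π/2)·n²/(n²−4); this shows that the second-order coefficient τ₂ in the perturbation expansion of the eigenvalue τ(a) is negative, so τ(a) < 1 for small a.) -/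
open Real

/-- Nonconstant integer cosine modes have mean zero over a period. -/
theorem integral_cos_int_mul_eq_zero (m : ℤ) (hm : m ≠ 0) :
    ∫ x in (-π)..π, Real.cos ((m : ℝ) * x) = 0 := by
  have hm' : (m : ℝ) ≠ 0 := Int.cast_ne_zero.mpr hm
  rw [intervalIntegral.integral_comp_mul_left (fun y => Real.cos y) hm', integral_cos,
    mul_neg, Real.sin_neg, Real.sin_int_mul_pi]
  simp

/-- Orthogonality of the sine modes `sin (k x)` and `sin (l x)` over a period, for
integers `k`, `l` that are not opposite. -/
theorem integral_sin_int_mul_sin_int_mul (k l : ℤ) (hkl : k + l ≠ 0) :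
    ∫ x in (-π)..π, Real.sin ((k : ℝ) * x) * Real.sin ((l : ℝ) * x) =
      if k = l then π else 0 := by
  have hprod : ∀ x : ℝ, Real.sin ((k : ℝ) * x) * Real.sin ((l : ℝ) * x) =
      (1 / 2) * (Real.cos (((k - l : ℤ) : ℝ) * x) - Real.cos (((k + l : ℤ) : ℝ) * x)) := by
    intro x
    push_cast
    rw [sub_mul, add_mul, Real.cos_sub, Real.cos_add]
    ring
  simp_rw [hprod]
  rw [intervalIntegral.integral_const_mul, intervalIntegral.integral_sub
    (Continuous.intervalIntegrable (by fun_prop) _ _)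
    (Continuous.intervalIntegrable (by fun_prop) _ _), integral_cos_int_mul_eq_zero _ hkl]
  split_ifs with h
  · simp [h]
    ring
  · rw [integral_cos_int_mul_eq_zero _ (sub_ne_zero.mpr h)]
    simp

/-- The integral over a period of a quadratic form in two distinct sine modes. -/
theorem integral_quadratic_form_sin (k l : ℤ) (hk : 0 < k) (hl : 0 < l) (hkl : k ≠ l)
    (a b c : ℝ) :
    ∫ x in (-π)..π, (a * (Real.sin ((k : ℝ) * x) * Real.sin ((k : ℝ) * x)) +
      b * (Real.sin ((l : ℝ) * x) * Real.sin ((l : ℝ) * x)) +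
      c * (Real.sin ((k : ℝ) * x) * Real.sin ((l : ℝ) * x))) = (a + b) * π := by
  rw [intervalIntegral.integral_add (Continuous.intervalIntegrable (by fun_prop) _ _)
      (Continuous.intervalIntegrable (by fun_prop) _ _),
    intervalIntegral.integral_add (Continuous.intervalIntegrable (by fun_prop) _ _)
      (Continuous.intervalIntegrable (by fun_prop) _ _)]
  simp only [intervalIntegral.integral_const_mul]
  rw [integral_sin_int_mul_sin_int_mul k k (by omega),
    integral_sin_int_mul_sin_int_mul l l (by omega),
    integral_sin_int_mul_sin_int_mul k l (by omega), if_pos rfl, if_pos rfl, if_neg hkl]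
  ring

/-- For `n ≥ 3` and
`q(x) = (n/2)(sin((n+1)x)/(n+2) − sin((n−1)x)/(n−2))`, one has
`∫ cos²(nx)sin²(x) − ∫ cos(nx)q(x)sin(x) = −2π/(n²−4) < 0` (integrals over `[−π,π]`);
hence the second-order coefficient `τ₂` of the eigenvalue branch `τ(a)` is negative. -/
theorem second_order_coefficient_odd_negative
    (n : ℕ) (hn : 3 ≤ n) (q : ℝ → ℝ)
    (hq : ∀ x, q x = ((n : ℝ) / 2) *
      (Real.sin (((n : ℝ) + 1) * x) / ((n : ℝ) + 2) -
        Real.sin (((n : ℝ) - 1) * x) / ((n : ℝ) - 2))) :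
    (∫ x in (-π)..π, Real.cos (n * x) ^ 2 * Real.sin x ^ 2) -
      (∫ x in (-π)..π, Real.cos (n * x) * q x * Real.sin x) =
      -2 * π / ((n : ℝ) ^ 2 - 4) ∧
    (∫ x in (-π)..π, Real.cos (n * x) ^ 2 * Real.sin x ^ 2) -
      (∫ x in (-π)..π, Real.cos (n * x) * q x * Real.sin x) < 0 := by
  have hn' : (3 : ℝ) ≤ n := by exact_mod_cast hn
  have h2 : (n : ℝ) - 2 ≠ 0 := by linarith
  have h2' : (n : ℝ) + 2 ≠ 0 := by linarith
  have h4 : 0 < (n : ℝ) ^ 2 - 4 := by nlinarith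
  have hcs : ∀ x : ℝ, Real.cos (n * x) * Real.sin x =
      (Real.sin ((((n : ℤ) + 1 : ℤ) : ℝ) * x) - Real.sin ((((n : ℤ) - 1 : ℤ) : ℝ) * x)) / 2 := by
    intro x
    push_cast
    rw [add_mul, sub_mul, one_mul, Real.sin_add, Real.sin_sub]
    ring
  have key := integral_quadratic_form_sin ((n : ℤ) + 1) ((n : ℤ) - 1)
    (by omega) (by omega) (by omega)
  have h_first : ∫ x in (-π)..π, Real.cos (n * x) ^ 2 * Real.sin x ^ 2 = π / 2 := by
    rw [show π / 2 = ((1 / 4 : ℝ) + 1 / 4) * π by ring, ← key (1 / 4) (1 / 4) (-1 / 2)]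
    congr 1
    funext x
    rw [← mul_pow, hcs]
    ring
  have h_second : ∫ x in (-π)..π, Real.cos (n * x) * q x * Real.sin x =
      (n / (4 * ((n : ℝ) + 2)) + n / (4 * ((n : ℝ) - 2))) * π := by
    rw [← key _ _ (-(n / (4 * ((n : ℝ) + 2)) + n / (4 * ((n : ℝ) - 2))))]
    congr 1
    funext x
    rw [mul_right_comm, hcs, hq]
    push_cast
    field_simp
    ring
  have h_eq : (∫ x in (-π)..π, Real.cos (n * x) ^ 2 * Real.sin x ^ 2) -
      (∫ x in (-π)..π, Real.cos (n * x) * q x * Real.sin x) =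
      -2 * π / ((n : ℝ) ^ 2 - 4) := by
    rw [h_first, h_second, show (n : ℝ) ^ 2 - 4 = (n + 2) * (n - 2) by ring]
    field_simp
    ring
  refine ⟨h_eq, ?_⟩
  rw [h_eq]
  exact div_neg_of_neg_of_pos (by linarith [Real.pi_pos]) h4
end

section
/- There exist infinitely differentiable functions T : ℝ → ℝ and Q : ℝ → ℝ with the following properties: (1) there is δ > 0 such that T(θ) = sin(θ) and Q(θ) = 1 for θ ∈ [0, δ] ∪ [π − δ, π]; (2) Q(θ) > 0 for all θ ∈ [0, π]; (3) sin²(θ)·T''(θ) + sin(θ)·cos(θ)·T'(θ) + (2·Q(θ)·sin²(θ) − 1)·T(θ) = 0 for all θ ∈ (0, π); (4) the set {θ ∈ (0, π) | T(θ) > 1} has infinitely many connected components. (In spherical coordinates, Φ(θ,φ) = T(θ)cos(φ) is then a smooth eigenfunction, with eigenvalue 2, of the Laplace–Beltrami operator of the conformal metric G·g₀ = Q·g₀ on S², whose super-level set {Φ > 1} has infinitely many connected components; hence the Extended Courant property fails for (S², Q·g₀).) -/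
open Real

/-- A set of reals has infinitely many connected components as soon as it contains a decreasing
sequence whose terms are pairwise separated by points outside the set. -/
lemma infinite_connectedComponents_of_separated {A : Set ℝ} (u : ℕ → ℝ) (hu : ∀ n, u n ∈ A)
    (hsep : ∀ m n, m < n → ∃ p, p ∉ A ∧ u n ≤ p ∧ p ≤ u m) :
    Infinite (ConnectedComponents A) := by
  have key : ∀ m n, m < n →
      (ConnectedComponents.mk (⟨u m, hu m⟩ : A)) ≠ ConnectedComponents.mk ⟨u n, hu n⟩ := by
    intro m n hmn heq
    rw [ConnectedComponents.coe_eq_coe'] at heq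
    obtain ⟨p, hpA, h1, h2⟩ := hsep m n hmn
    have hpre : IsPreconnected (Subtype.val '' connectedComponent (⟨u n, hu n⟩ : A)) :=
      isPreconnected_connectedComponent.image _ continuous_subtype_val.continuousOn
    obtain ⟨y, -, hy⟩ := hpre.ordConnected.out ⟨_, mem_connectedComponent, rfl⟩ ⟨_, heq, rfl⟩
      ⟨h1, h2⟩
    exact hpA (hy ▸ y.2)
  refine Infinite.of_injective (fun n => ConnectedComponents.mk (⟨u n, hu n⟩ : A)) ?_
  intro m n h
  rcases lt_trichotomy m n with hmn | hmn | hmn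
  · exact absurd h (key m n hmn)
  · exact hmn
  · exact absurd h.symm (key n m hmn)

/-- A smooth function on `ℝ` that is locally constant off `[0, 1]` has bounded derivative. -/
lemma exists_bound_deriv_of_eqOn {f : ℝ → ℝ} (hf : ContDiff ℝ (⊤ : ℕ∞) f) {c d : ℝ}
    (h0 : ∀ x < 0, f x = c) (h1 : ∀ x > 1, f x = d) :
    ∃ C, ∀ x, |deriv f x| ≤ C := by
  have hc : Continuous (deriv f) := hf.continuous_deriv (by simp)
  obtain ⟨C, hC⟩ := isCompact_Icc.exists_bound_of_continuousOn (s := Set.Icc (0 : ℝ) 1)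
    hc.continuousOn
  have hC0 : 0 ≤ C := (norm_nonneg _).trans (hC 0 (by simp))
  refine ⟨C, fun x => ?_⟩
  rcases lt_or_ge x 0 with hx | hx
  · have : f =ᶠ[nhds x] fun _ => c := by
      filter_upwards [Iio_mem_nhds hx] with y hy using h0 y hy
    simpa [this.deriv_eq] using hC0
  rcases lt_or_ge 1 x with hx' | hx'
  · have : f =ᶠ[nhds x] fun _ => d := by
      filter_upwards [Ioi_mem_nhds hx'] with y hy using h1 y hy
    simpa [this.deriv_eq] using hC0
  · exact hC x ⟨hx, hx'⟩

lemma smoothTransition_exists_bound_derivs :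
    ∃ C, ∀ x, |deriv smoothTransition x| ≤ C ∧ |deriv (deriv smoothTransition) x| ≤ C := by
  have hs : ContDiff ℝ (⊤ : ℕ∞) smoothTransition := smoothTransition.contDiff
  obtain ⟨C, hC⟩ := exists_bound_deriv_of_eqOn hs (c := 0) (d := 1)
    (fun x hx => smoothTransition.zero_of_nonpos hx.le)
    (fun x hx => smoothTransition.one_of_one_le hx.le)
  obtain ⟨D, hD⟩ := exists_bound_deriv_of_eqOn (f := deriv smoothTransition) (c := 0) (d := 0)
    (hs.iterate_deriv 1)
    (fun x hx => by
      have : smoothTransition =ᶠ[nhds x] fun _ => 0 := by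
        filter_upwards [Iio_mem_nhds hx] with y hy
          using smoothTransition.zero_of_nonpos (le_of_lt hy)
      simp [this.deriv_eq])
    (fun x hx => by
      have : smoothTransition =ᶠ[nhds x] fun _ => 1 := by
        filter_upwards [Ioi_mem_nhds hx] with y hy
          using smoothTransition.one_of_one_le (le_of_lt hy)
      simp [this.deriv_eq])
  exact ⟨max C D, fun x => ⟨(hC x).trans (le_max_left _ _), (hD x).trans (le_max_right _ _)⟩⟩

/-- A logarithmic cutoff: its derivatives at `x` are small compared with `1 / |x|` and
`1 / x ^ 2`. -/
lemma exists_log_cutoff {e : ℝ} (he : 0 < e) :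
    ∃ χ : ℝ → ℝ, ContDiff ℝ (⊤ : ℕ∞) χ ∧ (∀ x, 0 ≤ χ x ∧ χ x ≤ 1) ∧
      (∀ x, 1 ≤ |x| → χ x = 0) ∧ (∃ ρ > 0, ∀ x, |x| ≤ ρ → χ x = 1) ∧
      ∀ x, |x * deriv χ x| ≤ e ∧ |x ^ 2 * deriv (deriv χ) x| ≤ e := by
  obtain ⟨C₀, hC₀⟩ := smoothTransition_exists_bound_derivs
  obtain ⟨C, hC1, hC⟩ : ∃ C, 1 ≤ C ∧ ∀ x, |deriv smoothTransition x| ≤ C ∧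
      |deriv (deriv smoothTransition) x| ≤ C :=
    ⟨max 1 C₀, le_max_left _ _, fun x => ⟨(hC₀ x).1.trans (le_max_right _ _),
      (hC₀ x).2.trans (le_max_right _ _)⟩⟩
  obtain ⟨ε, hε, hε1, hεe⟩ : ∃ ε, 0 < ε ∧ ε ≤ 1 ∧ 6 * C * ε ≤ e := by
    refine ⟨min 1 (e / (6 * C)), by positivity, min_le_left _ _, ?_⟩
    calc 6 * C * min 1 (e / (6 * C)) ≤ 6 * C * (e / (6 * C)) := by gcongr; exact min_le_right _ _
      _ = e := by field_simp
  set ρ := exp (-1 / ε) with hρ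
  have hρ0 : 0 < ρ := exp_pos _
  have hpos : ∀ x : ℝ, 0 < x ^ 2 + ρ ^ 2 := fun x => by positivity
  have hs : ContDiff ℝ (⊤ : ℕ∞) smoothTransition := smoothTransition.contDiff
  have hs1 : ∀ t, HasDerivAt smoothTransition (deriv smoothTransition t) t := fun t =>
    (hs.differentiable (by simp) t).hasDerivAt
  have hs2 : ∀ t, HasDerivAt (deriv smoothTransition) (deriv (deriv smoothTransition) t) t :=
    fun t => ((hs.iterate_deriv 1).differentiable (by simp) t).hasDerivAt
  set a : ℝ → ℝ := fun x => -ε * log (x ^ 2 + ρ ^ 2) with ha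
  set a₁ : ℝ → ℝ := fun x => -ε * (2 * x / (x ^ 2 + ρ ^ 2)) with ha₁
  set a₂ : ℝ → ℝ := fun x => -ε * ((2 * ρ ^ 2 - 2 * x ^ 2) / (x ^ 2 + ρ ^ 2) ^ 2) with ha₂
  have hsq : ∀ x : ℝ, HasDerivAt (fun x => x ^ 2 + ρ ^ 2) (2 * x) x := fun x => by
    simpa using (hasDerivAt_pow 2 x).add_const (ρ ^ 2)
  have hda : ∀ x, HasDerivAt a (a₁ x) x := fun x => ((hsq x).log (hpos x).ne').const_mul (-ε)
  have hda₁ : ∀ x, HasDerivAt a₁ (a₂ x) x := fun x => by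
    have h := ((((hasDerivAt_id x).const_mul 2).div (hsq x) (hpos x).ne').const_mul (-ε))
    refine h.congr_deriv ?_
    simp only [ha₂, id]
    congr 2
    ring
  have hd1 : deriv (fun x => smoothTransition (a x)) =
      fun x => deriv smoothTransition (a x) * a₁ x :=
    funext fun x => ((hs1 (a x)).comp x (hda x)).deriv
  have hd2 : ∀ x, deriv (deriv fun x => smoothTransition (a x)) x =
      deriv (deriv smoothTransition) (a x) * a₁ x * a₁ x + deriv smoothTransition (a x) * a₂ x :=
    fun x => by
      rw [hd1]
      exact (((hs2 (a x)).comp x (hda x)).mul (hda₁ x)).deriv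
  have hb1 : ∀ x, |x * a₁ x| ≤ 2 * ε := fun x => by
    have : x * a₁ x = -(2 * ε) * (x ^ 2 / (x ^ 2 + ρ ^ 2)) := by simp only [ha₁]; ring
    rw [this, abs_mul, abs_neg, abs_of_pos (by positivity : 0 < 2 * ε),
      abs_of_nonneg (by positivity)]
    have : x ^ 2 / (x ^ 2 + ρ ^ 2) ≤ 1 := (div_le_one (hpos x)).2 (by nlinarith [sq_nonneg ρ])
    nlinarith
  have hb2 : ∀ x, |x ^ 2 * a₂ x| ≤ 2 * ε := fun x => by
    have : x ^ 2 * a₂ x = -(2 * ε) * (x ^ 2 * (ρ ^ 2 - x ^ 2) / (x ^ 2 + ρ ^ 2) ^ 2) := by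
      simp only [ha₂]; ring
    rw [this, abs_mul, abs_neg, abs_of_pos (by positivity : 0 < 2 * ε)]
    have : |x ^ 2 * (ρ ^ 2 - x ^ 2) / (x ^ 2 + ρ ^ 2) ^ 2| ≤ 1 := by
      rw [abs_div, abs_of_pos (pow_pos (hpos x) 2), div_le_one (pow_pos (hpos x) 2), abs_le]
      constructor <;> nlinarith [sq_nonneg (x ^ 2), sq_nonneg (ρ ^ 2),
        mul_nonneg (sq_nonneg x) (sq_nonneg ρ)]
    nlinarith
  refine ⟨fun x => smoothTransition (a x), ?_,
    fun x => ⟨smoothTransition.nonneg _, smoothTransition.le_one _⟩, ?_, ⟨ρ, hρ0, ?_⟩, ?_⟩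
  · refine hs.comp (contDiff_const.mul (ContDiff.log (by fun_prop) fun x => (hpos x).ne'))
  · intro x hx
    apply smoothTransition.zero_of_nonpos
    have : 1 ≤ x ^ 2 := by rw [← sq_abs]; nlinarith
    have : 0 ≤ log (x ^ 2 + ρ ^ 2) := log_nonneg (by nlinarith [sq_nonneg ρ])
    simp only [ha]; nlinarith
  · intro x hx
    apply smoothTransition.one_of_one_le
    have hx2 : x ^ 2 ≤ ρ ^ 2 := sq_le_sq' (by linarith [neg_abs_le x]) ((le_abs_self x).trans hx)
    have h1 : log (x ^ 2 + ρ ^ 2) ≤ log (2 * ρ ^ 2) := log_le_log (hpos x) (by linarith)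
    have h2 : log (2 * ρ ^ 2) = log 2 - 2 / ε := by
      rw [log_mul (by norm_num) (by positivity), log_pow, hρ, log_exp]
      push_cast; ring
    have h3 : log 2 ≤ 1 := by linarith [log_two_lt_d9]
    have h4 : ε * (2 / ε) = 2 := by field_simp
    simp only [ha]
    nlinarith
  · intro x
    obtain ⟨hσ1, hσ2⟩ := hC (a x)
    constructor
    · rw [hd1]
      calc |x * (deriv smoothTransition (a x) * a₁ x)|
          = |deriv smoothTransition (a x)| * |x * a₁ x| := by rw [← abs_mul]; ring_nf
        _ ≤ C * (2 * ε) := by gcongr; exact hb1 x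
        _ ≤ e := by nlinarith
    · rw [hd2]
      calc |x ^ 2 * (deriv (deriv smoothTransition) (a x) * a₁ x * a₁ x +
              deriv smoothTransition (a x) * a₂ x)|
          = |deriv (deriv smoothTransition) (a x) * (x * a₁ x) * (x * a₁ x) +
              deriv smoothTransition (a x) * (x ^ 2 * a₂ x)| := by ring_nf
        _ ≤ |deriv (deriv smoothTransition) (a x)| * |x * a₁ x| * |x * a₁ x| +
              |deriv smoothTransition (a x)| * |x ^ 2 * a₂ x| := by
            refine (abs_add_le _ _).trans_eq ?_
            simp only [abs_mul]
        _ ≤ C * (2 * ε) * (2 * ε) + C * (2 * ε) := by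
            gcongr
            exacts [hb1 x, hb1 x, hb2 x]
        _ ≤ e := by nlinarith [mul_nonneg (by linarith : 0 ≤ C) (mul_nonneg hε.le (sub_nonneg.2 hε1))]

/-- In the coordinate `x = θ - π / 2`, the operator `f ↦ f - sin θ (sin θ f')'`, which is
`f ↦ f - f''` in the Mercator coordinate of the sphere. -/
noncomputable def mercatorOp (f : ℝ → ℝ) (x : ℝ) : ℝ :=
  f x - cos x ^ 2 * deriv (deriv f) x + cos x * sin x * deriv f x

lemma ContDiff.mercatorOp {f : ℝ → ℝ} (hf : ContDiff ℝ (⊤ : ℕ∞) f) :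
    ContDiff ℝ (⊤ : ℕ∞) (mercatorOp f) := by
  have h1 : ContDiff ℝ (⊤ : ℕ∞) (deriv f) := hf.iterate_deriv 1
  have h2 : ContDiff ℝ (⊤ : ℕ∞) (deriv (deriv f)) := hf.iterate_deriv 2
  exact (hf.sub ((contDiff_cos.pow 2).mul h2)).add ((contDiff_cos.mul contDiff_sin).mul h1)

lemma mercatorOp_add_const_mul {f g : ℝ → ℝ} (hf : ContDiff ℝ (⊤ : ℕ∞) f)
    (hg : ContDiff ℝ (⊤ : ℕ∞) g) (k x : ℝ) :
    mercatorOp (fun y => f y + k * g y) x = mercatorOp f x + k * mercatorOp g x := by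
  have hd : ∀ {h : ℝ → ℝ}, ContDiff ℝ (⊤ : ℕ∞) h → ∀ y, HasDerivAt h (deriv h y) y :=
    fun hh y => (hh.differentiable (by simp) y).hasDerivAt
  have h1 : deriv (fun y => f y + k * g y) = fun y => deriv f y + k * deriv g y :=
    funext fun y => ((hd hf y).add ((hd hg y).const_mul k)).deriv
  have h2 : deriv (fun y => deriv f y + k * deriv g y) x =
      deriv (deriv f) x + k * deriv (deriv g) x :=
    ((hd (hf.iterate_deriv 1) x).add ((hd (hg.iterate_deriv 1) x).const_mul k)).deriv
  simp only [_root_.mercatorOp, h1, h2]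
  ring

lemma Filter.EventuallyEq.mercatorOp_eq {f g : ℝ → ℝ} {x : ℝ} (h : f =ᶠ[nhds x] g) :
    mercatorOp f x = mercatorOp g x := by
  simp only [mercatorOp, h.eq_of_nhds, h.deriv_eq, h.deriv.deriv_eq]

lemma mercatorOp_cos (x : ℝ) : mercatorOp cos x = 2 * cos x ^ 3 := by
  have h : deriv cos = fun y => -sin y := funext fun y => Real.deriv_cos
  have h2 : deriv (fun y => -sin y) x = -cos x := (hasDerivAt_sin x).neg.deriv
  simp only [mercatorOp, h, h2]
  linear_combination (-cos x) * sin_sq_add_cos_sq x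

lemma mercatorOp_cos_add_cutoff {χ : ℝ → ℝ} (hχ : ContDiff ℝ (⊤ : ℕ∞) χ) (x : ℝ) :
    mercatorOp (fun y => cos y + χ y * (1 - cos y)) x =
      2 * cos x ^ 3 * (1 - χ x) + χ x - cos x ^ 2 * (1 - cos x) * deriv (deriv χ) x
        - 2 * cos x ^ 2 * (sin x * deriv χ x) + cos x * (1 - cos x) * (sin x * deriv χ x) := by
  have hd1 : ∀ y, HasDerivAt χ (deriv χ y) y := fun y =>
    (hχ.differentiable (by simp) y).hasDerivAt
  have hd2 : ∀ y, HasDerivAt (deriv χ) (deriv (deriv χ) y) y := fun y =>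
    ((hχ.iterate_deriv 1).differentiable (by simp) y).hasDerivAt
  have hw : ∀ y, HasDerivAt (fun y => 1 - cos y) (sin y) y := fun y => by
    simpa using (hasDerivAt_cos y).const_sub 1
  have h1 : deriv (fun y => cos y + χ y * (1 - cos y)) =
      fun y => -sin y + (deriv χ y * (1 - cos y) + χ y * sin y) :=
    funext fun y => ((hasDerivAt_cos y).add ((hd1 y).mul (hw y))).deriv
  have h2 : deriv (fun y => -sin y + (deriv χ y * (1 - cos y) + χ y * sin y)) x =
      -cos x + ((deriv (deriv χ) x * (1 - cos x) + deriv χ x * sin x) +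
        (deriv χ x * sin x + χ x * cos x)) :=
    ((hasDerivAt_sin x).neg.add (((hd2 x).mul (hw x)).add
      ((hd1 x).mul (hasDerivAt_sin x)))).deriv
  simp only [mercatorOp, h1, h2]
  linear_combination (-cos x + χ x * cos x) * sin_sq_add_cos_sq x

lemma half_le_cos {x : ℝ} (hx : |x| ≤ 1) : 1 / 2 ≤ cos x := by
  have : x ^ 2 ≤ 1 := by rw [← sq_abs]; nlinarith [abs_nonneg x]
  linarith [one_sub_sq_div_two_le_cos (x := x)]

lemma mercatorOp_cos_add_cutoff_lower_bound {χ : ℝ → ℝ} (hχ : ContDiff ℝ (⊤ : ℕ∞) χ) {x : ℝ}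
    (hx : |x| ≤ 1) (h01 : 0 ≤ χ x ∧ χ x ≤ 1) (h1 : |x * deriv χ x| ≤ 1 / 64)
    (h2 : |x ^ 2 * deriv (deriv χ) x| ≤ 1 / 64) :
    1 / 8 ≤ mercatorOp (fun y => cos y + χ y * (1 - cos y)) x := by
  rw [mercatorOp_cos_add_cutoff hχ]
  have hc : 1 / 2 ≤ cos x := half_le_cos hx
  have hc1 : cos x ≤ 1 := cos_le_one x
  have hsin : |sin x * deriv χ x| ≤ 1 / 64 := by
    refine le_trans ?_ h1
    rw [abs_mul, abs_mul]
    exact mul_le_mul_of_nonneg_right abs_sin_le_abs (abs_nonneg _)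
  have hw : |(1 - cos x) * deriv (deriv χ) x| ≤ 1 / 64 := by
    refine le_trans ?_ h2
    rw [abs_mul, abs_mul, abs_of_nonneg (by linarith : 0 ≤ 1 - cos x), abs_of_nonneg (sq_nonneg x)]
    gcongr
    nlinarith [one_sub_sq_div_two_le_cos (x := x), sq_nonneg x]
  have hc2 : cos x ^ 2 ≤ 1 := by nlinarith
  have e1 : |cos x ^ 2 * (1 - cos x) * deriv (deriv χ) x| ≤ 1 / 64 := by
    rw [mul_assoc, abs_mul, abs_of_nonneg (sq_nonneg _)]
    nlinarith [abs_nonneg ((1 - cos x) * deriv (deriv χ) x)]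
  have e2 : |2 * cos x ^ 2 * (sin x * deriv χ x)| ≤ 2 / 64 := by
    rw [abs_mul, abs_of_nonneg (by positivity)]
    nlinarith [abs_nonneg (sin x * deriv χ x)]
  have e3 : |cos x * (1 - cos x) * (sin x * deriv χ x)| ≤ 1 / 64 := by
    rw [abs_mul, abs_of_nonneg (mul_nonneg (by linarith) (by linarith))]
    have : cos x * (1 - cos x) ≤ 1 := by nlinarith
    nlinarith [abs_nonneg (sin x * deriv χ x)]
  have hc3 : 1 / 8 ≤ cos x ^ 3 := by
    have := pow_le_pow_left₀ (by norm_num) hc 3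
    norm_num at this ⊢
    exact this
  have e4 : 1 / 4 ≤ 2 * cos x ^ 3 * (1 - χ x) + χ x := by
    nlinarith [mul_le_mul_of_nonneg_right hc3 (sub_nonneg.2 h01.2)]
  linarith [(abs_le.1 e1).2, (abs_le.1 e2).2, (abs_le.1 e3).1]

/-- A smooth function vanishing exactly at the points `0` and `1 / (n π)` for nonzero integers
`n`. -/
lemma exists_smooth_flat_oscillation :
    ∃ g : ℝ → ℝ, ContDiff ℝ (⊤ : ℕ∞) g ∧ (∀ x, 0 ≤ g x) ∧
      ∀ x, g x ≠ 0 ↔ x ≠ 0 ∧ sin x⁻¹ ≠ 0 := by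
  have hopen : IsOpen {x : ℝ | x ≠ 0 ∧ sin x⁻¹ ≠ 0} := by
    have hc : ContinuousOn (fun x : ℝ => sin x⁻¹) {x | x ≠ 0} :=
      continuous_sin.comp_continuousOn (continuousOn_inv₀)
    exact hc.isOpen_inter_preimage isOpen_ne isOpen_ne
  obtain ⟨g, hsupp, hg, hrange⟩ := hopen.exists_contDiff_support_eq (n := ⊤)
  refine ⟨g, hg, fun x => (hrange ⟨x, rfl⟩).1, fun x => ?_⟩
  rw [← Function.mem_support, hsupp, Set.mem_ofPred_eq]

/-- A smooth modification of the cosine on `[-1, 1]`, positive there, staying a strict supersolution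
of `mercatorOp`, whose part above height `1` oscillates near `0`. -/
lemma exists_oscillating_cap :
    ∃ S : ℝ → ℝ, ContDiff ℝ (⊤ : ℕ∞) S ∧ (∀ x, 1 ≤ |x| → S x = cos x) ∧
      (∀ x, |x| ≤ 1 → 0 < S x ∧ 0 < mercatorOp S x) ∧
      ∃ ρ > 0, ∀ x, |x| ≤ ρ → (1 < S x ↔ x ≠ 0 ∧ sin x⁻¹ ≠ 0) := by
  obtain ⟨χ, hχ, h01, hout, ⟨ρ, hρ, hin⟩, hder⟩ := exists_log_cutoff (e := 1 / 64) (by norm_num)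
  obtain ⟨g, hg, hg0, hgne⟩ := exists_smooth_flat_oscillation
  have hT : ContDiff ℝ (⊤ : ℕ∞) fun y => cos y + χ y * (1 - cos y) :=
    contDiff_cos.add (hχ.mul (contDiff_const.sub contDiff_cos))
  have hG : ContDiff ℝ (⊤ : ℕ∞) fun y => χ y * g y := hχ.mul hg
  obtain ⟨M, hM⟩ := isCompact_Icc.exists_bound_of_continuousOn (s := Set.Icc (-1 : ℝ) 1)
    hG.mercatorOp.continuous.continuousOn
  have hM0 : 0 ≤ M := (norm_nonneg _).trans (hM 0 (by simp))
  set k : ℝ := 1 / (16 * (M + 1)) with hk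
  have hk0 : 0 < k := by positivity
  have hkM : k * M ≤ 1 / 16 := by
    rw [hk, one_div_mul_eq_div, div_le_div_iff₀ (by positivity) (by norm_num)]
    linarith
  refine ⟨fun y => (cos y + χ y * (1 - cos y)) + k * (χ y * g y), hT.add (contDiff_const.mul hG),
    fun x hx => by simp [hout x hx], fun x hx => ⟨?_, ?_⟩, ρ, hρ, fun x hx => ?_⟩
  · have := half_le_cos hx
    have h1 := mul_nonneg (h01 x).1 (sub_nonneg.2 (cos_le_one x))
    have h2 := mul_nonneg hk0.le (mul_nonneg (h01 x).1 (hg0 x))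
    linarith
  · rw [mercatorOp_add_const_mul hT hG]
    have h1 := mercatorOp_cos_add_cutoff_lower_bound hχ hx (h01 x) (hder x).1 (hder x).2
    have h2 := (abs_le.1 (hM x (abs_le.1 hx))).1
    nlinarith
  · rw [← hgne]
    simp only [hin x hx]
    rw [show cos x + 1 * (1 - cos x) + k * (1 * g x) = 1 + k * g x by ring]
    constructor
    · rintro h h0
      simp [h0] at h
    · intro h
      have := mul_pos hk0 (lt_of_le_of_ne (hg0 x) h.symm)
      linarith

/-- The conformal factor attached to a cap. -/
lemma exists_conformal_factor {S : ℝ → ℝ} (hS : ContDiff ℝ (⊤ : ℕ∞) S)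
    (hout : ∀ x, 1 ≤ |x| → S x = cos x) (hpos : ∀ x, |x| ≤ 1 → 0 < S x ∧ 0 < mercatorOp S x) :
    ∃ q : ℝ → ℝ, ContDiff ℝ (⊤ : ℕ∞) q ∧ (∀ x, 1 < |x| → q x = 1) ∧ (∀ x, 0 < q x) ∧
      ∀ x, 2 * q x * cos x ^ 2 * S x = mercatorOp S x := by
  set N : ℝ → ℝ := fun x => mercatorOp S x - 2 * cos x ^ 2 * S x with hN
  have hN0 : ∀ x, 1 < |x| → N x = 0 := fun x hx => by
    have h : S =ᶠ[nhds x] cos := by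
      filter_upwards [(isOpen_lt continuous_const continuous_abs).mem_nhds hx] with y hy
        using hout y hy.le
    simp only [hN, h.mercatorOp_eq, mercatorOp_cos, hout x hx.le]
    ring
  have hD : ContDiff ℝ (⊤ : ℕ∞) fun x => 2 * cos x ^ 2 * S x :=
    (contDiff_const.mul (contDiff_cos.pow 2)).mul hS
  have hDpos : ∀ x, |x| ≤ 1 → 0 < 2 * cos x ^ 2 * S x := fun x hx => by
    have h1 := half_le_cos hx
    have h2 := (hpos x hx).1
    positivity
  have hq : ∀ x, |x| ≤ 1 → 1 + N x / (2 * cos x ^ 2 * S x) =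
      mercatorOp S x / (2 * cos x ^ 2 * S x) := fun x hx => by
    rw [hN, sub_div, div_self (hDpos x hx).ne']
    ring
  refine ⟨fun x => 1 + N x / (2 * cos x ^ 2 * S x), ?_, fun x hx => by simp [hN0 x hx],
    fun x => ?_, fun x => ?_⟩
  · rw [contDiff_iff_contDiffAt]
    intro x
    rcases le_or_gt |x| 1 with hx | hx
    · exact contDiffAt_const.add
        ((hS.mercatorOp.sub hD).contDiffAt.div hD.contDiffAt (hDpos x hx).ne')
    · refine (contDiffAt_const (c := (1 : ℝ))).congr_of_eventuallyEq ?_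
      filter_upwards [(isOpen_lt continuous_const continuous_abs).mem_nhds hx] with y hy
      simp [hN0 y hy]
  · rcases le_or_gt |x| 1 with hx | hx
    · simp only [hq x hx]
      exact div_pos (hpos x hx).2 (hDpos x hx)
    · simp [hN0 x hx]
  · rcases le_or_gt |x| 1 with hx | hx
    · simp only [hq x hx]
      have := (hDpos x hx).ne'
      rw [mul_assoc, mul_right_comm, ← mul_assoc 2, mul_div_cancel₀ _ this]
    · have := hN0 x hx
      simp only [this, zero_div, add_zero, mul_one]
      simp only [hN] at this
      linarith

/-- There are `C^∞` functions `T, Q : ℝ → ℝ` with `T(θ) = sin θ` and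
`Q ≡ 1` near `0` and `π`, `Q > 0` on `[0,π]`, satisfying on `(0,π)` the ODE
`sin²θ·T'' + sinθcosθ·T' + (2Q sin²θ − 1)T = 0`, and such that `{θ ∈ (0,π) | T(θ) > 1}`
has infinitely many connected components. (Then `Φ(θ,φ) = T(θ)cos(φ)` is an
eigenfunction with eigenvalue `2` of the Laplace–Beltrami operator of the conformal
metric `Q·g₀` on `S²`, whose super-level set `{Φ > 1}` has infinitely many connected
components; hence the Extended Courant property fails for `(S², Q·g₀)`.) -/
theorem sphere_eigenvalue_two_superlevel_infinitely_many_components :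
    ∃ T Q : ℝ → ℝ, ContDiff ℝ (⊤ : ℕ∞) T ∧ ContDiff ℝ (⊤ : ℕ∞) Q ∧
      (∃ δ : ℝ, 0 < δ ∧ ∀ θ : ℝ,
        θ ∈ Set.Icc (0 : ℝ) δ ∪ Set.Icc (π - δ) π → T θ = Real.sin θ ∧ Q θ = 1) ∧
      (∀ θ ∈ Set.Icc (0 : ℝ) π, 0 < Q θ) ∧
      (∀ θ ∈ Set.Ioo (0 : ℝ) π,
        Real.sin θ ^ 2 * deriv (deriv T) θ + Real.sin θ * Real.cos θ * deriv T θ +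
          (2 * Q θ * Real.sin θ ^ 2 - 1) * T θ = 0) ∧
      Infinite (ConnectedComponents {θ : ℝ // θ ∈ Set.Ioo (0 : ℝ) π ∧ 1 < T θ}) := by
  obtain ⟨S, hS, hout, hpos, ρ, hρ, hcap⟩ := exists_oscillating_cap
  obtain ⟨q, hq, hq1, hqpos, hode⟩ := exists_conformal_factor hS hout hpos
  have hshift : ContDiff ℝ (⊤ : ℕ∞) fun θ : ℝ => θ - π / 2 := contDiff_id.sub contDiff_const
  refine ⟨fun θ => S (θ - π / 2), fun θ => q (θ - π / 2), hS.comp hshift, hq.comp hshift,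
    ⟨1 / 2, by norm_num, fun θ hθ => ?_⟩, fun θ _ => hqpos _, fun θ _ => ?_, ?_⟩
  · have h1 : 1 < |θ - π / 2| := by
      rcases hθ with hθ | hθ
      · exact lt_abs.2 (Or.inr (by linarith [hθ.2, pi_gt_d2]))
      · exact lt_abs.2 (Or.inl (by linarith [hθ.1, pi_gt_d2]))
    exact ⟨(hout _ h1.le).trans (cos_sub_pi_div_two θ), hq1 _ h1⟩
  · have h1 : deriv (fun θ => S (θ - π / 2)) = fun θ => deriv S (θ - π / 2) :=
      funext fun y => deriv_comp_sub_const ..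
    have h2 : deriv (fun θ => deriv S (θ - π / 2)) θ = deriv (deriv S) (θ - π / 2) :=
      deriv_comp_sub_const ..
    have h3 := hode (θ - π / 2)
    simp only [mercatorOp, cos_sub_pi_div_two, sin_sub_pi_div_two] at h3
    simp only [h1, h2]
    linear_combination h3
  · obtain ⟨K, hK⟩ := exists_nat_gt (1 / min ρ 1)
    have hr : 0 < min ρ 1 := lt_min hρ one_pos
    have hK0 : (0 : ℝ) < K := (one_div_pos.2 hr).trans hK
    have hsmall : ∀ t : ℝ, (K : ℝ) ≤ t → 0 < (t * π)⁻¹ ∧ (t * π)⁻¹ ≤ ρ ∧ (t * π)⁻¹ ≤ 1 := by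
      intro t ht
      have h1 : 1 / min ρ 1 ≤ t * π := by nlinarith [pi_gt_three]
      have h2 : (t * π)⁻¹ ≤ min ρ 1 := by
        rw [inv_le_comm₀ (by nlinarith [pi_gt_three]) hr, inv_eq_one_div]
        exact h1
      exact ⟨by have := pi_pos; have := hK0.trans_le ht; positivity,
        h2.trans (min_le_left _ _), h2.trans (min_le_right _ _)⟩
    have habove : ∀ t : ℝ, (K : ℝ) ≤ t →
        (1 < S (π / 2 + (t * π)⁻¹ - π / 2) ↔ sin (t * π) ≠ 0) := by
      intro t ht
      obtain ⟨h0, h1, -⟩ := hsmall t ht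
      rw [add_sub_cancel_left, hcap _ ((abs_of_pos h0).trans_le h1), inv_inv]
      exact and_iff_right h0.ne'
    have hKn : ∀ n : ℕ, (K : ℝ) ≤ ((n + K : ℕ) : ℝ) := fun n => by push_cast; simp
    refine infinite_connectedComponents_of_separated
      (A := {θ | θ ∈ Set.Ioo (0 : ℝ) π ∧ 1 < S (θ - π / 2)})
      (fun n => π / 2 + ((((n + K : ℕ) : ℝ) + 1 / 2) * π)⁻¹) (fun n => ?_) (fun m n hmn => ?_)
    · have ht : (K : ℝ) ≤ ((n + K : ℕ) : ℝ) + 1 / 2 := by linarith [hKn n]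
      obtain ⟨h0, -, h1⟩ := hsmall _ ht
      refine ⟨⟨by linarith [pi_pos], by linarith [pi_gt_three]⟩, (habove _ ht).2 ?_⟩
      rw [show (((n + K : ℕ) : ℝ) + 1 / 2) * π = π / 2 + (n + K : ℕ) * π by ring,
        sin_add_nat_mul_pi, sin_pi_div_two]
      simp
    · refine ⟨π / 2 + (((n + K : ℕ) : ℝ) * π)⁻¹,
        fun h => (habove _ (hKn n)).1 h.2 (sin_nat_mul_pi _), ?_, ?_⟩
      · have : 0 < ((n + K : ℕ) : ℝ) := hK0.trans_le (hKn n)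
        have := pi_pos
        gcongr
        linarith
      · have : 0 < ((m + K : ℕ) : ℝ) := hK0.trans_le (hKn m)
        have := pi_pos
        have : (m : ℝ) + 1 ≤ n := by exact_mod_cast hmn
        gcongr
        push_cast
        linarith
end
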